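/- Let X be a special (abstract) rank one group with unipotent subgroups A and B, and let 1 ≠ a₁ ∈ A and 1 ≠ a₂ ∈ A with a₁a₂ ≠ 1. Set b₃ = b(a₂)⁻¹·b(a₁)·b(a₂) (a nontrivial element of B) and a₃ = a(b₃). Then a₂·a₃ ≠ 1. -/

import Mathlib

/-- The conjugate subgroup `S^g = g⁻¹ S g`. -/
def conjSub {X : Type*} [Group X] (S : Subgroup X) (g : X) : Subgroup X :=
  S.map (MulAut.conj g⁻¹).toMonoidHom

/-- `X` is an (abstract) rank one group with unipotent subgroups `A` and `B`:
`A ≠ B`, `X = ⟨A, B⟩`, for each `1 ≠ a ∈ A` there is `1 ≠ b ∈ B` with `A^b = B^a`,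
and vice versa. -/
structure IsRankOneGroup {X : Type*} [Group X] (A B : Subgroup X) : Prop where
  ne : A ≠ B
  gen : A ⊔ B = ⊤
  exB : ∀ a ∈ A, a ≠ 1 → ∃ b ∈ B, b ≠ 1 ∧ conjSub A b = conjSub B a
  exA : ∀ b ∈ B, b ≠ 1 → ∃ a ∈ A, a ≠ 1 ∧ conjSub B a = conjSub A b

/-- `bf` implements `a ↦ b(a)`, the unique `1 ≠ b ∈ B` with `A^b = B^a`, for `1 ≠ a ∈ A`. -/
def IsBFun {X : Type*} [Group X] (A B : Subgroup X) (bf : X → X) : Prop :=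
  ∀ a ∈ A, a ≠ 1 → bf a ∈ B ∧ bf a ≠ 1 ∧ conjSub A (bf a) = conjSub B a

/-- `af` implements `b ↦ a(b)`, the unique `1 ≠ a ∈ A` with `B^a = A^b`, for `1 ≠ b ∈ B`. -/
def IsAFun {X : Type*} [Group X] (A B : Subgroup X) (af : X → X) : Prop :=
  ∀ b ∈ B, b ≠ 1 → af b ∈ A ∧ af b ≠ 1 ∧ conjSub B (af b) = conjSub A b

/-- `X` is special: `b(a⁻¹) = b(a)⁻¹` for all `1 ≠ a ∈ A`. -/
def IsSpecialBFun {X : Type*} [Group X] (A B : Subgroup X) (bf : X → X) : Prop :=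
  IsBFun A B bf ∧ ∀ a ∈ A, a ≠ 1 → bf a⁻¹ = (bf a)⁻¹

/-- The special rank one group condition, phrased without a chosen `b`-function. -/
def IsSpecial {X : Type*} [Group X] (A B : Subgroup X) : Prop :=
  ∃ bf : X → X, IsSpecialBFun A B bf

theorem conjSub_mul {X : Type*} [Group X] (S : Subgroup X) (g k : X) :
    conjSub S (g * k) = conjSub (conjSub S g) k := by
  unfold conjSub
  rw [Subgroup.map_map]
  congr 1
  ext x
  simp [mul_assoc]

theorem conjSub_one {X : Type*} [Group X] (S : Subgroup X) : conjSub S 1 = S := by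
  ext x
  simp [conjSub]

theorem conjSub_of_mem {X : Type*} [Group X] {S : Subgroup X} {g : X} (hg : g ∈ S) :
    conjSub S g = S := by
  ext x
  simp only [conjSub, Subgroup.mem_map]
  constructor
  · rintro ⟨y, hy, rfl⟩
    simpa using S.mul_mem (S.mul_mem (S.inv_mem hg) hy) hg
  · intro hx
    exact ⟨g * x * g⁻¹, S.mul_mem (S.mul_mem hg hx) (S.inv_mem hg), by simp [mul_assoc]⟩

theorem conjSub_mul_inv_of_eq {X : Type*} [Group X] {S T : Subgroup X} {g k : X}
    (hgk : conjSub S g = conjSub T k) : conjSub S (g * k⁻¹) = T := by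
  rw [conjSub_mul, hgk, ← conjSub_mul, mul_inv_cancel, conjSub_one]

theorem IsRankOneGroup.symm {X : Type*} [Group X] {A B : Subgroup X}
    (h : IsRankOneGroup A B) : IsRankOneGroup B A :=
  ⟨h.ne.symm, by rw [sup_comm]; exact h.gen, h.exA, h.exB⟩

/-- Distinct elements of `A` conjugate `B` to distinct subgroups. -/
theorem IsRankOneGroup.eq_of_conjSub_eq {X : Type*} [Group X] {A B : Subgroup X}
    (h : IsRankOneGroup A B) {a a' : X} (ha : a ∈ A) (ha' : a' ∈ A)
    (haa' : conjSub B a = conjSub B a') : a = a' := by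
  by_contra hne
  obtain ⟨b, hb, -, hAb⟩ := h.exB (a * a'⁻¹) (A.mul_mem ha (A.inv_mem ha'))
    (fun h1 => hne (mul_inv_eq_one.mp h1))
  rw [conjSub_mul_inv_of_eq haa', ← conjSub_of_mem hb] at hAb
  have hAB := conjSub_mul_inv_of_eq hAb
  rw [mul_inv_cancel, conjSub_one] at hAB
  exact h.ne hAB

/-- In a special rank one group, for `1 ≠ a₁, a₂ ∈ A` with `a₁a₂ ≠ 1`, the element
`b₃ = b(a₂)⁻¹·b(a₁)·b(a₂)` is a nontrivial element of `B` and `a₂·a(b₃) ≠ 1`. -/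
theorem specialRankOne_a2a3_ne_one {X : Type*} [Group X] (A B : Subgroup X)
    (h : IsRankOneGroup A B) (bf : X → X) (hbf : IsSpecialBFun A B bf)
    (af : X → X) (haf : IsAFun A B af)
    (a₁ a₂ : X) (ha₁ : a₁ ∈ A) (ha₁1 : a₁ ≠ 1) (ha₂ : a₂ ∈ A) (ha₂1 : a₂ ≠ 1)
    (h12 : a₁ * a₂ ≠ 1) :
    (bf a₂)⁻¹ * bf a₁ * bf a₂ ∈ B ∧ (bf a₂)⁻¹ * bf a₁ * bf a₂ ≠ 1 ∧
      a₂ * af ((bf a₂)⁻¹ * bf a₁ * bf a₂) ≠ 1 := by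
  obtain ⟨hb, hinv⟩ := hbf
  obtain ⟨hb₁, hb₁1, hAb₁⟩ := hb a₁ ha₁ ha₁1
  obtain ⟨hb₂, -, -⟩ := hb a₂ ha₂ ha₂1
  have hAb₂ := (hb a₂⁻¹ (A.inv_mem ha₂) (inv_ne_one.mpr ha₂1)).2.2
  rw [hinv a₂ ha₂ ha₂1] at hAb₂
  have hb₃ : (bf a₂)⁻¹ * bf a₁ * bf a₂ ∈ B :=
    B.mul_mem (B.mul_mem (B.inv_mem hb₂) hb₁) hb₂
  have hb₃1 : (bf a₂)⁻¹ * bf a₁ * bf a₂ ≠ 1 := by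
    intro h1
    rw [mul_eq_one_iff_eq_inv, mul_eq_left] at h1
    exact hb₁1 h1
  refine ⟨hb₃, hb₃1, fun h23 => h12 ?_⟩
  have hBa₃ := (haf _ hb₃ hb₃1).2.2
  rw [← inv_eq_of_mul_eq_one_right h23, ← hAb₂] at hBa₃
  have hb₁₂ := h.symm.eq_of_conjSub_eq (B.inv_mem hb₂) hb₃ hBa₃
  have hb₁₂' : bf a₁ = (bf a₂)⁻¹ := by
    rw [mul_assoc, left_eq_mul] at hb₁₂
    exact eq_inv_of_mul_eq_one_left hb₁₂
  rw [hb₁₂', hAb₂] at hAb₁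
  rw [← h.eq_of_conjSub_eq (A.inv_mem ha₂) ha₁ hAb₁, inv_mul_cancel]
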